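/- Let p ≥ 1, c ≥ 1 be integers and b = pc + 1. Let 0 = s_0 < s_1 < ⋯ < s_{k−1} < s_k = n. Then the probability that the set of d-descents of the (b,n,p)-shuffle equals {s_1,…,s_{k−1},n} is P(s_1,…,s_{k−1},n) = b^{−n} · det( f(i,j) )_{i,j = 0,…,k−1}, where f(i,j) = binom(s_{j+1} − s_i + b − 1, b − 1) for 0 ≤ i ≤ k−1 and 0 ≤ j ≤ k−2, and f(i,k−1) = binom(n − s_i + b − 1, b − 1) − binom(n − s_i + c, c) for 0 ≤ i ≤ k−1. -/

import Mathlib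

open scoped Classical

noncomputable section

/-- Binomial coefficient with integer top, taken to be `0` when the top is negative
(so in particular `zchoose a r = 0` whenever `a < r`). -/
def zchoose (a : ℤ) (r : ℕ) : ℕ := if 0 ≤ a then a.toNat.choose r else 0

/-- Rank of a color `r ∈ Z_p` in the order `0, p-1, p-2, …, 1` used to define
the linear order on `Σ = {1,…,n} × Z_p`. -/
def rho (p : ℕ) (r : ZMod p) : ℕ := if r = 0 then 0 else p - r.val

/-- The linear order on `Σ`: `(i,r) < (j,s)` iff the color of `r` comes strictly earlier
(in the order `0, p-1, …, 1`), or the colors agree and `i < j`. -/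
def sigmaLt (p : ℕ) (x y : ℕ × ZMod p) : Prop :=
  rho p x.2 < rho p y.2 ∨ (rho p x.2 = rho p y.2 ∧ x.1 < y.1)

/-- The position part of the `(b,n,p)`-shuffle determined by labels `A`:
`σ(i) = #{j : A j < A i, or A j = A i and j ≤ i}`. -/
def shufflePos {n b : ℕ} (A : Fin n → Fin b) (i : Fin n) : ℕ :=
  (Finset.univ.filter fun j : Fin n => A j < A i ∨ (A j = A i ∧ j ≤ i)).card

/-- The color part of the `(b,n,p)`-shuffle determined by labels `A`: `σ_c(i) = A i mod p`. -/
def shuffleCol (p : ℕ) {n b : ℕ} (A : Fin n → Fin b) (i : Fin n) : ZMod p :=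
  ((A i : ℕ) : ZMod p)

/-- The pair `(σ(i), σ_c(i))` of the `(b,n,p)`-shuffle determined by labels `A`. -/
def shufflePair (p : ℕ) {n b : ℕ} (A : Fin n → Fin b) (i : Fin n) : ℕ × ZMod p :=
  (shufflePos A i, shuffleCol p A i)

/-- The shuffle `π[A]` has a d-descent at position `i+1` (positions are `1,…,n`):
for positions `< n` this means `(σ(i),σ_c(i)) > (σ(i+1),σ_c(i+1))`,
and at position `n` it means `σ_c(n) ≠ 0`. -/
def shuffleHasDDescentAt (p : ℕ) {n b : ℕ} (A : Fin n → Fin b) (i : Fin n) : Prop :=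
  if h : (i : ℕ) + 1 < n then
    sigmaLt p (shufflePair p A ⟨(i : ℕ) + 1, h⟩) (shufflePair p A i)
  else shuffleCol p A i ≠ 0

/-- The set of d-descent positions (a subset of `{1,…,n}`) of the shuffle `π[A]`. -/
def shuffleDDescentSet (p : ℕ) {n b : ℕ} (A : Fin n → Fin b) : Finset ℕ :=
  (Finset.univ.filter fun i : Fin n => shuffleHasDDescentAt p A i).image fun i => (i : ℕ) + 1

def upL (b : ℕ) : Module.End ℝ (ℕ → ℝ) where
  toFun g := fun x => ∑ y ∈ Finset.range b, if x ≤ y then g y else 0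
  map_add' g h := by
    funext x
    simp only [Pi.add_apply, ← Finset.sum_add_distrib]
    refine Finset.sum_congr rfl fun y _ => ?_
    split_ifs <;> simp
  map_smul' r g := by
    funext x
    simp only [Pi.smul_apply, smul_eq_mul, RingHom.id_apply, Finset.mul_sum]
    refine Finset.sum_congr rfl fun y _ => ?_
    split_ifs <;> simp

def dnL (b : ℕ) (g : ℕ → ℝ) : ℕ → ℝ :=
  fun x => ∑ y ∈ Finset.range b, if y < x then g y else 0

lemma upL_apply (b : ℕ) (g : ℕ → ℝ) (x : ℕ) :
    upL b g x = ∑ y ∈ Finset.range b, if x ≤ y then g y else 0 := rfl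

lemma up_add_dn (b : ℕ) (g : ℕ → ℝ) :
    upL b g + dnL b g = (upL b g 0) • (fun _ => (1 : ℝ)) := by
  funext x
  simp only [Pi.add_apply, upL_apply, dnL, ← Finset.sum_add_distrib, Pi.smul_apply, smul_eq_mul,
    mul_one]
  refine Finset.sum_congr rfl fun y _ => ?_
  by_cases h : x ≤ y
  · simp [h]
  · simp [h, not_le.1 h]

lemma upL_congr (b : ℕ) {g h : ℕ → ℝ} (H : ∀ y, y < b → g y = h y) : upL b g = upL b h := by
  funext x
  simp only [upL_apply]
  refine Finset.sum_congr rfl fun y hy => ?_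
  rw [H y (Finset.mem_range.1 hy)]

/-- iterates on indicator of `[0,c]` -/
lemma up_pow_ind (b c : ℕ) (hc : c < b) (m : ℕ) :
    (upL b ^ m) (fun x => if x ≤ c then (1 : ℝ) else 0)
      = fun x => if x ≤ c then (((m + (c - x)).choose m : ℕ) : ℝ) else 0 := by
  induction m with
  | zero => funext x; simp
  | succ m ih =>
    rw [pow_succ', Module.End.mul_apply, ih]
    funext x
    simp only [upL_apply, ← ite_and]
    rw [← Finset.sum_filter]
    by_cases hx : x ≤ c
    · have : (Finset.range b).filter (fun a => x ≤ a ∧ a ≤ c) = Finset.Icc x c := by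
        ext y; simp; omega
      rw [this, if_pos hx]
      have h2 := Nat.sum_range_add_choose (c - x) m
      have h3 : m + 1 + (c - x) = c - x + m + 1 := by omega
      rw [h3, ← h2]
      push_cast
      refine Finset.sum_nbij' (fun y => c - y) (fun i => c - i) ?_ ?_ ?_ ?_ ?_
      · intro y hy; simp at hy ⊢; omega
      · intro y hy; simp at hy ⊢; omega
      · intro y hy; simp at hy ⊢; omega
      · intro y hy; simp at hy ⊢; omega
      · intro y hy; rw [Nat.add_comm]
    · rw [if_neg hx]
      apply Finset.sum_eq_zero
      intro y hy
      simp at hy; omega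

def opL (b : ℕ) (S : ℕ → Prop) (u : ℕ) (g : ℕ → ℝ) : ℕ → ℝ :=
  if S u then dnL b g else upL b g

def WW (b c : ℕ) (S : ℕ → Prop) : ℕ → ℕ → (ℕ → ℝ)
  | 0, _ => fun x => if x = c then 1 else 0
  | l + 1, u => opL b S (u + 1) (WW b c S l (u + 1))

def extW (c : ℕ) {n : ℕ} (A : Fin n → ℕ) (t : ℕ) : ℕ := if h : t < n then A ⟨t, h⟩ else c

def okW (c : ℕ) (S : ℕ → Prop) (u : ℕ) {n : ℕ} (A : Fin n → ℕ) : Prop :=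
  ∀ t, t < n → (extW c A (t + 1) < extW c A t ↔ S (u + t + 1))

lemma extW_cons_succ (c : ℕ) {n : ℕ} (x : ℕ) (A : Fin n → ℕ) (t : ℕ) :
    extW c (Fin.cons x A : Fin (n + 1) → ℕ) (t + 1) = extW c A t := by
  unfold extW
  by_cases h : t < n
  · rw [dif_pos h, dif_pos (by omega)]
    exact Fin.cons_succ (α := fun _ => ℕ) x A ⟨t, h⟩
  · rw [dif_neg h, dif_neg (by omega)]

lemma extW_cons_zero (c : ℕ) {n : ℕ} (x : ℕ) (A : Fin n → ℕ) :
    extW c (Fin.cons x A : Fin (n + 1) → ℕ) 0 = x := by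
  simp [extW]

lemma okW_cons (c : ℕ) (S : ℕ → Prop) (u : ℕ) {n : ℕ} (x : ℕ) (A : Fin n → ℕ) :
    okW c S u (Fin.cons x A : Fin (n + 1) → ℕ) ↔
      (extW c A 0 < x ↔ S (u + 1)) ∧ okW c S (u + 1) A := by
  unfold okW
  constructor
  · intro h
    refine ⟨?_, fun t ht => ?_⟩
    · have := h 0 (by omega)
      rwa [extW_cons_succ, extW_cons_zero] at this
    · have := h (t + 1) (by omega)
      rw [extW_cons_succ, extW_cons_succ] at this
      rw [this]; ring_nf
  · rintro ⟨h0, h⟩ t ht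
    cases t with
    | zero => rw [extW_cons_succ, extW_cons_zero]; exact h0
    | succ t =>
      rw [extW_cons_succ, extW_cons_succ, h t (by omega)]
      ring_nf

lemma cons_val {b l : ℕ} (y : Fin b) (A : Fin l → Fin b) :
    (fun i => ((Fin.cons y A : Fin (l + 1) → Fin b) i : ℕ))
      = (Fin.cons (y : ℕ) (fun i => (A i : ℕ)) : Fin (l + 1) → ℕ) := by
  funext i
  refine Fin.cases ?_ (fun j => ?_) i <;> simp

lemma sum_cons {b l : ℕ} (F : (Fin (l + 1) → Fin b) → ℝ) :
    ∑ A, F A = ∑ y : Fin b, ∑ A : Fin l → Fin b, F (Fin.cons y A) := by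
  rw [← (Fin.consEquiv (fun _ : Fin (l + 1) => Fin b)).sum_comp, Fintype.sum_prod_type]
  rfl

lemma count_W (b c : ℕ) (hc : c < b) (S : ℕ → Prop) (l : ℕ) : ∀ (u x : ℕ),
    (∑ A : Fin l → Fin b,
      if okW c S u (Fin.cons x (fun i => (A i : ℕ)) : Fin (l + 1) → ℕ) then (1 : ℝ) else 0)
      = WW b c S (l + 1) u x := by
  induction l with
  | zero =>
    intro u x
    rw [Fintype.sum_unique]
    simp only [okW_cons]
    have h1 : extW c (fun i : Fin 0 => ((default : Fin 0 → Fin b) i : ℕ)) 0 = c := by simp [extW]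
    have h2 : okW c S (u + 1) (fun i : Fin 0 => ((default : Fin 0 → Fin b) i : ℕ)) := by
      intro t ht; omega
    rw [h1]
    simp only [h2, and_true]
    show _ = opL b S (u + 1) (fun x => if x = c then 1 else 0) x
    unfold opL
    by_cases hS : S (u + 1)
    · rw [if_pos hS]
      simp only [dnL, ← ite_and, and_comm (b := _ = c), hS, iff_true]
      simp only [ite_and, Finset.sum_ite_eq']
      simp [hc]
    · rw [if_neg hS]
      simp only [upL_apply, ← ite_and, and_comm (b := _ = c), hS, iff_false]
      simp only [ite_and, Finset.sum_ite_eq']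
      simp [hc]
  | succ l ih =>
    intro u x
    rw [sum_cons]
    have key : ∀ y : Fin b, (∑ A : Fin l → Fin b,
        if okW c S u (Fin.cons x (fun i => ((Fin.cons y A : Fin (l + 1) → Fin b) i : ℕ)) :
          Fin (l + 1 + 1) → ℕ) then (1 : ℝ) else 0)
        = if ((y : ℕ) < x ↔ S (u + 1)) then WW b c S (l + 1) (u + 1) y else 0 := by
      intro y
      rw [← ih (u + 1) y]
      by_cases h : ((y : ℕ) < x ↔ S (u + 1))
      · rw [if_pos h]
        refine Finset.sum_congr rfl fun A _ => ?_
        rw [okW_cons, cons_val, extW_cons_zero]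
        simp only [h, true_and]
      · rw [if_neg h]
        refine Finset.sum_eq_zero fun A _ => ?_
        rw [okW_cons, cons_val, extW_cons_zero]
        simp only [h, false_and, if_false]
    rw [Finset.sum_congr rfl fun y _ => key y]
    rw [Fin.sum_univ_eq_sum_range
      (fun y => if (y < x ↔ S (u + 1)) then WW b c S (l + 1) (u + 1) y else 0) b]
    show _ = opL b S (u + 1) (WW b c S (l + 1) (u + 1)) x
    unfold opL
    by_cases hS : S (u + 1)
    · rw [if_pos hS]
      simp only [hS, iff_true, dnL]
    · rw [if_neg hS]
      simp only [hS, iff_false, upL_apply, not_lt]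

lemma count_total (b c : ℕ) (hc : c < b) (S : ℕ → Prop) (n : ℕ) (hn : 1 ≤ n) :
    (∑ A : Fin n → Fin b, if okW c S 0 (fun i => (A i : ℕ)) then (1 : ℝ) else 0)
      = upL b (WW b c S n 0) 0 := by
  obtain ⟨l, rfl⟩ : ∃ l, n = l + 1 := ⟨n - 1, by omega⟩
  rw [sum_cons]
  simp only [cons_val, count_W b c hc S l]
  rw [Fin.sum_univ_eq_sum_range (fun y => WW b c S (l + 1) 0 y) b]
  simp [upL_apply]

/-- Hessenberg determinant via Cramer. -/
lemma hess_det (m : ℕ) (M : Matrix (Fin (m + 1)) (Fin (m + 1)) ℝ) (N : ℕ → ℝ)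
    (h0 : ∀ i j : Fin (m + 1), (j : ℕ) + 1 < i → M i j = 0)
    (h1 : ∀ i j : Fin (m + 1), (j : ℕ) + 1 = i → M i j = 1)
    (hN : N (m + 1) = 1)
    (hM : ∀ i : Fin (m + 1), ∑ j : Fin (m + 1), M i j * ((-1) ^ (j : ℕ) * N (j + 1))
      = if i = 0 then N 0 else 0) :
    M.det = N 0 := by
  set v : Fin (m + 1) → ℝ := fun j => (-1) ^ (j : ℕ) * N (j + 1) with hv
  have hMv : M.mulVec v = fun i => if i = 0 then N 0 else 0 := by
    funext i
    exact hM i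
  have h2 : M.adjugate.mulVec (M.mulVec v) = M.det • v := by
    rw [Matrix.mulVec_mulVec, Matrix.adjugate_mul, Matrix.smul_mulVec, Matrix.one_mulVec]
  have h3 := congrFun h2 (Fin.last m)
  rw [hMv] at h3
  simp only [Matrix.mulVec, dotProduct, mul_ite, mul_zero, Finset.sum_ite_eq', Finset.mem_univ,
    if_true, Pi.smul_apply, smul_eq_mul] at h3
  rw [Matrix.adjugate_fin_succ_eq_det_submatrix] at h3
  have h4 : (M.submatrix (Fin.succAbove 0) (Fin.succAbove (Fin.last m))).det = 1 := by
    rw [Matrix.det_of_isUpperTriangular]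
    · refine Finset.prod_eq_one fun i _ => ?_
      simp only [Matrix.submatrix_apply]
      apply h1
      simp
    · intro i j hij
      simp only [Matrix.submatrix_apply]
      apply h0
      simp
      exact hij
  rw [h4] at h3
  simp only [hv, Fin.val_last, hN, Fin.val_zero] at h3
  have h5 : ((-1 : ℝ) ^ m) ≠ 0 := by positivity
  have h6 : (-1 : ℝ) ^ m * N 0 = (-1) ^ m * M.det := by
    simpa [mul_comm] using h3
  exact (mul_left_cancel₀ h5 h6).symm

lemma up_pow_ind_zero (b c : ℕ) (hc : c < b) (m : ℕ) :
    (upL b ^ m) (fun x => if x ≤ c then (1 : ℝ) else 0) 0 = (((m + c).choose c : ℕ) : ℝ) := by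
  rw [up_pow_ind b c hc m]
  simp [Nat.choose_symm_add]

lemma up_pow_one_zero (b : ℕ) (hb : 1 ≤ b) (m : ℕ) :
    (upL b ^ m) (fun _ => (1 : ℝ)) 0 = (((m + (b - 1)).choose (b - 1) : ℕ) : ℝ) := by
  cases m with
  | zero => simp
  | succ m =>
    rw [← up_pow_ind_zero b (b - 1) (by omega) (m + 1), pow_succ, Module.End.mul_apply,
      Module.End.mul_apply]
    rw [upL_congr b (g := fun _ => (1 : ℝ)) (h := fun x => if x ≤ b - 1 then (1 : ℝ) else 0)]
    intro y hy
    rw [if_pos (by omega)]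

lemma zchoose_nonneg (a r : ℕ) (x : ℤ) (h : x = a) : zchoose x r = a.choose r := by
  subst h; simp [zchoose]

lemma s_lt {k : ℕ} {s : ℕ → ℕ} (hmono : ∀ i, i < k → s i < s (i + 1)) {i j : ℕ}
    (hij : i < j) (hj : j ≤ k) : s i < s j := by
  induction j with
  | zero => omega
  | succ j ih =>
    have h := hmono j (by omega)
    rcases Nat.lt_succ_iff_lt_or_eq.1 hij with h1 | h1
    · exact (ih h1 (by omega)).trans h
    · subst h1; exact h

lemma s_le {k : ℕ} {s : ℕ → ℕ} (hmono : ∀ i, i < k → s i < s (i + 1)) {i j : ℕ}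
    (hij : i ≤ j) (hj : j ≤ k) : s i ≤ s j := by
  rcases hij.lt_or_eq with h | h
  · exact (s_lt hmono h hj).le
  · rw [h]

/-- runs -/
lemma WW_run (b c n k : ℕ) (s : ℕ → ℕ) (hmono : ∀ i, i < k → s i < s (i + 1))
    (hlast : s k = n) (j : ℕ) (hj : j < k) (d : ℕ) : ∀ u, s j ≤ u → u + d + 1 = s (j + 1) →
    WW b c (fun t => t ∈ (Finset.Icc 1 k).image s) (n - u) u =
      (upL b ^ d) (dnL b (WW b c (fun t => t ∈ (Finset.Icc 1 k).image s)
        (n - s (j + 1)) (s (j + 1)))) := by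
  have hle : s (j + 1) ≤ n := hlast ▸ s_le hmono (by omega) le_rfl
  induction d with
  | zero =>
    intro u hu h
    obtain ⟨l, hl⟩ : ∃ l, n - u = l + 1 := ⟨n - u - 1, by omega⟩
    have hl' : n - s (j + 1) = l := by omega
    rw [hl, hl']
    simp only [WW, opL, pow_zero, Module.End.one_apply]
    have h' : u + 1 = s (j + 1) := by omega
    rw [h', if_pos]
    exact Finset.mem_image_of_mem s (Finset.mem_Icc.2 ⟨by omega, by omega⟩)
  | succ d ih =>
    intro u hu h
    obtain ⟨l, hl⟩ : ∃ l, n - u = l + 1 := ⟨n - u - 1, by omega⟩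
    have ih' := ih (u + 1) (by omega) (by omega)
    have hl' : n - (u + 1) = l := by omega
    rw [hl'] at ih'
    rw [hl, pow_succ', Module.End.mul_apply, ← ih']
    simp only [WW, opL]
    rw [if_neg]
    intro hmem
    obtain ⟨i, hi, hi2⟩ := Finset.mem_image.1 hmem
    rw [Finset.mem_Icc] at hi
    rcases Nat.lt_or_ge j i with h1 | h1
    · have := s_le hmono (i := j + 1) (j := i) (by omega) hi.2
      omega
    · have := s_le hmono h1 (by omega)
      omega

lemma det_eq (p c n k : ℕ) (hc : 1 ≤ c) (hn : 1 ≤ n) (hk : 1 ≤ k)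
    (b : ℕ) (hcb : c < b)
    (s : ℕ → ℕ) (hs0 : s 0 = 0) (hmono : ∀ i, i < k → s i < s (i + 1))
    (hlast : s k = n) :
        (Matrix.of fun i j : Fin k =>
          if (j : ℕ) = k - 1 then
            (zchoose ((n : ℤ) - s (i : ℕ) + b - 1) (b - 1) : ℝ)
              - (zchoose ((n : ℤ) - s (i : ℕ) + c) c : ℝ)
          else (zchoose ((s ((j : ℕ) + 1) : ℤ) - s (i : ℕ) + b - 1) (b - 1) : ℝ)).det
      = upL b (WW b c (fun t => t ∈ (Finset.Icc 1 k).image s) n 0) 0 := by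
  obtain ⟨m, rfl⟩ : ∃ m, k = m + 1 := ⟨k - 1, by omega⟩
  set G : ℕ → ℕ → ℝ := fun u => WW b c (fun t => t ∈ (Finset.Icc 1 (m + 1)).image s) (n - u) u
    with hG
  set N : ℕ → ℝ := fun i => if i < m + 1 then upL b (G (s i)) 0 else 1 with hN
  set E : ℕ → ℕ → ℝ := fun i j => (upL b ^ (s (j + 1) - s i)) (dnL b (G (s (j + 1)))) 0 with hE
  set f : ℕ → ℕ → ℝ := fun i j =>
          if j = m + 1 - 1 then
            (zchoose ((n : ℤ) - s i + b - 1) (b - 1) : ℝ)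
              - (zchoose ((n : ℤ) - s i + c) c : ℝ)
          else (zchoose ((s (j + 1) : ℤ) - s i + b - 1) (b - 1) : ℝ) with hf
  have hsn : ∀ i, i ≤ m → s i < n := fun i hi => hlast ▸ s_lt hmono (by omega) le_rfl
  have hGrun : ∀ j, j < m + 1 → ∀ i, i ≤ j → (upL b ^ (s j - s i + 1)) (G (s j)) 0 = E i j := by
    intro j hj i hij
    have h1 := hmono j hj
    have h2 := s_le hmono hij (by omega)
    have := WW_run b c n (m + 1) s hmono hlast j hj (s (j + 1) - s j - 1) (s j) le_rfl (by omega)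
    simp only [hE, hG]
    have he : s (j + 1) - s i = s j - s i + 1 + (s (j + 1) - s j - 1) := by omega
    rw [this, ← Module.End.mul_apply, ← pow_add, he]
  have hNE : ∀ i, i < m + 1 → N i = E i i := by
    intro i hi
    rw [← hGrun i hi i le_rfl]
    simp only [hN]
    rw [if_pos hi, Nat.sub_self, zero_add, pow_one]
  have hzc : ∀ x y : ℕ, y ≤ x → (zchoose ((x : ℤ) - y + b - 1) (b - 1) : ℝ)
      = (upL b ^ (x - y)) (fun _ => (1 : ℝ)) 0 := by
    intro x y hxy
    rw [up_pow_one_zero b (by omega), zchoose_nonneg (x - y + (b - 1))]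
    omega
  have hlastE : ∀ i, i ≤ m → f i m = E i m := by
    intro i hi
    have h1 := hsn i hi
    simp only [hf]
    rw [if_pos (by omega), hzc n (s i) h1.le, zchoose_nonneg (n - s i + c) c _ (by omega),
      ← up_pow_ind_zero b c hcb]
    simp only [hE, hlast]
    rw [← Pi.sub_apply, ← map_sub]
    refine congrArg (fun g => (upL b ^ (n - s i)) g 0) ?_
    funext x
    simp only [Pi.sub_apply, hG, Nat.sub_self, WW, dnL]
    simp only [← ite_and, and_comm (b := _ = c)]
    simp only [ite_and, Finset.sum_ite_eq']
    by_cases hx : x ≤ c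
    · simp [hx]
    · simp [hx, hcb, not_le.1 hx]
  have hmid : ∀ i j, i ≤ j → j < m → f i j * N (j + 1) = E i j + E i (j + 1) := by
    intro i j hij hj
    have h1 := s_le hmono (i := i) (j := j + 1) (by omega) (by omega)
    simp only [hf]
    rw [if_neg (by omega), hzc _ _ h1, ← hGrun (j + 1) (by omega) i (by omega)]
    simp only [hE, hN]
    rw [if_pos (by omega), pow_succ, Module.End.mul_apply, ← Pi.add_apply, ← map_add,
      add_comm (dnL b _) (upL b _), up_add_dn, map_smul, Pi.smul_apply, smul_eq_mul, mul_comm]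
  have htel : ∀ i, ∀ d j, i ≤ j → j + d = m →
      ∑ t ∈ Finset.Ico j (m + 1), f i t * ((-1) ^ t * N (t + 1)) = (-1) ^ j * E i j := by
    intro i d
    induction d with
    | zero =>
      intro j hij hj
      obtain rfl : j = m := by omega
      rw [Nat.Ico_succ_singleton, Finset.sum_singleton, hlastE i hij]
      simp [hN, mul_comm]
    | succ d ih =>
      intro j hij hj
      rw [Finset.sum_eq_sum_Ico_succ_bot (by omega), ih (j + 1) (by omega) (by omega)]
      have := hmid i j hij (by omega)
      rw [mul_left_comm, this, pow_succ]
      ring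
  have hf0 : ∀ i j, j + 1 < i → i ≤ m → f i j = 0 := by
    intro i j h hi
    have := s_lt hmono h (by omega)
    simp only [hf]
    rw [if_neg (by omega)]
    simp only [zchoose]
    split_ifs with h1
    · rw [Nat.choose_eq_zero_of_lt (by omega)]; simp
    · simp
  have hf1 : ∀ i j, j + 1 = i → i ≤ m → f i j = 1 := by
    intro i j h hi
    subst h
    simp only [hf]
    rw [if_neg (by omega), hzc _ _ le_rfl]
    simp
  have hfin := hess_det m (Matrix.of fun i j : Fin (m + 1) => f i j) N
    (fun i j h => hf0 i j h (by omega)) (fun i j h => hf1 i j h (by omega))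
    (by simp [hN]) ?_
  · refine Eq.trans hfin ?_
    simp [hN, hG, hs0]
  · intro i
    simp only [Matrix.of_apply]
    rw [Fin.sum_univ_eq_sum_range (fun t => f i t * ((-1) ^ t * N (t + 1))) (m + 1)]
    obtain ⟨i, hi⟩ := i
    cases i with
    | zero =>
      have := htel 0 m 0 le_rfl (by omega)
      rw [Finset.range_eq_Ico]
      simp only [Fin.mk_zero', Fin.val_zero, if_true]
      rw [this, hNE 0 (by omega)]; simp
    | succ i =>
      rw [if_neg (by simp [Fin.ext_iff])]
      have := htel (i + 1) (m - (i + 1)) (i + 1) le_rfl (by omega)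
      rw [← Finset.sum_range_add_sum_Ico _ (show i + 1 ≤ m + 1 by omega), this,
        Finset.sum_range_succ, Finset.sum_eq_zero, hf1 (i + 1) i rfl (by omega),
        hNE (i + 1) (by omega), pow_succ]
      · ring
      · intro t ht
        rw [hf0 (i + 1) t (by simpa using ht) (by omega), zero_mul]

/-! relabelling -/

def phiN (p c : ℕ) (a : ℕ) : ℕ :=
  if a % p = 0 then a / p else 1 + (p - a % p) * c + a / p

def rhoN (p a : ℕ) : ℕ := if a % p = 0 then 0 else p - a % p

lemma rho_cast (p a : ℕ) (hp : 1 ≤ p) : rho p (a : ZMod p) = rhoN p a := by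
  haveI : NeZero p := ⟨by omega⟩
  unfold rho rhoN
  rw [ZMod.val_natCast]
  congr 1
  rw [ZMod.natCast_eq_zero_iff, Nat.dvd_iff_mod_eq_zero]

lemma phiN_eq (p c a : ℕ) (hp : 1 ≤ p) (ha : a < p * c + 1) :
    (rhoN p a = 0 ∧ phiN p c a = a / p ∧ a / p ≤ c) ∨
    (1 ≤ rhoN p a ∧ rhoN p a < p ∧ phiN p c a = 1 + rhoN p a * c + a / p ∧ a / p < c) := by
  unfold rhoN phiN
  have hm : a % p < p := Nat.mod_lt _ hp
  have hd := Nat.div_add_mod a p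
  by_cases h : a % p = 0
  · left
    simp only [h, if_true, true_and]
    exact Nat.le_of_mul_le_mul_left (by omega) hp
  · right
    simp only [h, if_false, true_and]
    refine ⟨by omega, by omega, ?_⟩
    exact Nat.lt_of_mul_lt_mul_left (a := p) (by omega)

lemma phiN_lt (p c a : ℕ) (hp : 1 ≤ p) (ha : a < p * c + 1) : phiN p c a < p * c + 1 := by
  rcases phiN_eq p c a hp ha with ⟨_, h2, h3⟩ | ⟨_, h2, h3, h4⟩
  · rw [h2]; nlinarith
  · rw [h3]; nlinarith

lemma phiN_gt_c (p c a : ℕ) (hp : 1 ≤ p) (ha : a < p * c + 1) :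
    c < phiN p c a ↔ rhoN p a ≠ 0 := by
  rcases phiN_eq p c a hp ha with ⟨h1, h2, h3⟩ | ⟨h1, h2, h3, h4⟩
  · rw [h2, h1]; simp; exact h3
  · rw [h3]
    constructor
    · intro; omega
    · intro; have := Nat.mul_le_mul_right c h1; have := Nat.zero_le (a / p); omega

lemma phiN_mono (p c a a' : ℕ) (hp : 1 ≤ p) (ha : a < p * c + 1) (ha' : a' < p * c + 1)
    (h : rhoN p a < rhoN p a' ∨ (rhoN p a = rhoN p a' ∧ a < a')) :
    phiN p c a < phiN p c a' := by
  have hq : rhoN p a = rhoN p a' → a < a' → a / p < a' / p := by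
    intro he hlt
    have h1 := Nat.div_add_mod a p
    have h2 := Nat.div_add_mod a' p
    have hm : a % p = a' % p := by
      have hm1 : a % p < p := Nat.mod_lt _ hp
      have hm2 : a' % p < p := Nat.mod_lt _ hp
      unfold rhoN at he
      split_ifs at he <;> omega
    exact Nat.lt_of_mul_lt_mul_left (a := p) (by omega)
  rcases phiN_eq p c a hp ha with ⟨h1, h2, h3⟩ | ⟨h1, h2, h3, h4⟩ <;>
  rcases phiN_eq p c a' hp ha' with ⟨g1, g2, g3⟩ | ⟨g1, g2, g3, g4⟩
  · have := hq (by omega)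
    rw [h2, g2]
    apply hq <;> omega
  · rw [h2, g3]; have := Nat.mul_le_mul_right c g1; have := Nat.zero_le (a' / p); omega
  · omega
  · rw [h3, g3]
    rcases h with h | ⟨h, h'⟩
    · have := Nat.mul_le_mul_right c (Nat.succ_le_of_lt h)
      rw [Nat.succ_mul] at this
      have := Nat.zero_le (a' / p)
      omega
    · have := hq h h'
      rw [h]; omega

lemma phiN_lt_iff (p c a a' : ℕ) (hp : 1 ≤ p) (ha : a < p * c + 1) (ha' : a' < p * c + 1) :
    phiN p c a < phiN p c a' ↔ (rhoN p a < rhoN p a' ∨ (rhoN p a = rhoN p a' ∧ a < a')) := by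
  refine ⟨fun h => ?_, phiN_mono p c a a' hp ha ha'⟩
  by_contra hcon
  have h2 : (rhoN p a' < rhoN p a ∨ (rhoN p a' = rhoN p a ∧ a' < a)) ∨ a = a' := by omega
  rcases h2 with h2 | h2
  · have := phiN_mono p c a' a hp ha' ha h2
    omega
  · subst h2; omega

def phiF (p c : ℕ) (hp : 1 ≤ p) (a : Fin (p * c + 1)) : Fin (p * c + 1) :=
  ⟨phiN p c a, phiN_lt p c a hp a.2⟩

lemma phiF_bij (p c : ℕ) (hp : 1 ≤ p) : Function.Bijective (phiF p c hp) := by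
  rw [← Finite.injective_iff_bijective]
  intro a a' h
  have h1 : phiN p c a = phiN p c a' := congrArg Fin.val h
  by_contra hne
  have hne' : (a : ℕ) ≠ a' := fun h => hne (Fin.ext h)
  have i1 := phiN_mono p c a a' hp a.2 a'.2
  have i2 := phiN_mono p c a' a hp a'.2 a.2
  omega

lemma shufflePos_lt {n b : ℕ} (A : Fin n → Fin b) (i i' : Fin n) (h : i < i') :
    shufflePos A i' < shufflePos A i ↔ A i' < A i := by
  unfold shufflePos
  constructor
  · intro hlt
    by_contra hcon
    refine absurd hlt (not_lt.2 (Finset.card_le_card ?_))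
    intro j hj
    simp only [Finset.mem_filter, Finset.mem_univ, true_and] at hj ⊢
    rw [not_lt] at hcon
    rcases hj with hj | ⟨hj, hj'⟩
    · exact Or.inl (hj.trans_le hcon)
    · rcases hcon.lt_or_eq with h2 | h2
      · exact Or.inl (hj ▸ h2)
      · exact Or.inr ⟨hj.trans h2, hj'.trans h.le⟩
  · intro hlt
    refine Finset.card_lt_card (Finset.ssubset_iff_of_subset ?_ |>.2 ⟨i, ?_, ?_⟩)
    · intro j hj
      simp only [Finset.mem_filter, Finset.mem_univ, true_and] at hj ⊢
      rcases hj with hj | ⟨hj, hj'⟩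
      · exact Or.inl (hj.trans hlt)
      · exact Or.inl (hj ▸ hlt)
    · simp
    · simp only [Finset.mem_filter, Finset.mem_univ, true_and]
      rintro (h2 | ⟨h2, _⟩)
      · exact absurd hlt (not_lt.2 h2.le)
      · exact absurd hlt (by rw [h2]; exact lt_irrefl _)

lemma desc_iff (p c n : ℕ) (hp : 1 ≤ p) (A : Fin n → Fin (p * c + 1)) (i : Fin n) :
    shuffleHasDDescentAt p A i ↔
      extW c (fun j => ((phiF p c hp (A j) : Fin (p * c + 1)) : ℕ)) ((i : ℕ) + 1)
        < extW c (fun j => ((phiF p c hp (A j) : Fin (p * c + 1)) : ℕ)) i := by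
  unfold shuffleHasDDescentAt extW
  rw [dif_pos i.2]
  by_cases h : (i : ℕ) + 1 < n
  · rw [dif_pos h, dif_pos h]
    simp only [sigmaLt, shufflePair, shuffleCol, phiF, rho_cast _ _ hp]
    rw [phiN_lt_iff p c _ _ hp (A _).2 (A _).2, shufflePos_lt A i ⟨i + 1, h⟩ (by
      rw [Fin.lt_def]; simp)]
    rfl
  · rw [dif_neg h, dif_neg h]
    simp only [phiF, shuffleCol]
    rw [phiN_gt_c p c _ hp (A _).2, ← rho_cast _ _ hp]
    haveI : NeZero p := ⟨by omega⟩
    unfold rho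
    have := ZMod.val_lt (((A i : ℕ) : ZMod p))
    constructor
    · intro hne
      rw [if_neg hne]
      exact Nat.sub_ne_zero_of_lt this
    · intro h1 h2
      exact h1 (if_pos h2)

lemma mem_dset (p n b : ℕ) (A : Fin n → Fin b) (x : ℕ) :
    x ∈ shuffleDDescentSet p A ↔ ∃ i : Fin n, shuffleHasDDescentAt p A i ∧ (i : ℕ) + 1 = x := by
  unfold shuffleDDescentSet
  simp [Finset.bind_def, Finset.mem_sup, Finset.pure_def]

lemma set_iff (p c n k : ℕ) (hp : 1 ≤ p) (A : Fin n → Fin (p * c + 1))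
    (s : ℕ → ℕ) (hs0 : s 0 = 0) (hmono : ∀ i, i < k → s i < s (i + 1))
    (hlast : s k = n) :
    shuffleDDescentSet p A = (Finset.Icc 1 k).image s ↔
      okW c (fun t => t ∈ (Finset.Icc 1 k).image s) 0
        (fun j => ((phiF p c hp (A j) : Fin (p * c + 1)) : ℕ)) := by
  have hmem : ∀ t (ht : t < n), (t + 1 ∈ shuffleDDescentSet p A ↔
      shuffleHasDDescentAt p A ⟨t, ht⟩) := by
    intro t ht
    rw [mem_dset]
    constructor
    · rintro ⟨i, hi, h⟩
      have : i = ⟨t, ht⟩ := Fin.ext (by simpa using h)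
      exact this ▸ hi
    · intro h
      exact ⟨_, h, rfl⟩
  unfold okW
  constructor
  · intro h t ht
    rw [← desc_iff p c n hp A ⟨t, ht⟩, ← hmem t ht, h, Nat.zero_add]
  · intro h
    ext x
    by_cases hx : 1 ≤ x ∧ x ≤ n
    · obtain ⟨t, rfl⟩ : ∃ t, x = t + 1 := ⟨x - 1, by omega⟩
      have := h t (by omega)
      rw [hmem t (by omega), desc_iff p c n hp A ⟨t, by omega⟩]
      simp only [Nat.zero_add] at this
      exact this
    · constructor
      · intro h1
        obtain ⟨i, _, rfl⟩ := (mem_dset _ _ _ _ _).1 h1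
        have := i.2
        omega
      · intro h1
        obtain ⟨i, hi, rfl⟩ := Finset.mem_image.1 h1
        rw [Finset.mem_Icc] at hi
        have h2 := s_lt hmono (i := 0) (j := i) (by omega) hi.2
        have h3 := s_le hmono hi.2 le_rfl
        omega

/-- **Theorem (determinantal formula for the `(b,n,p)`-shuffle, case `s_k = n`).**
For `b = pc + 1` and `0 = s_0 < s_1 < ⋯ < s_{k-1} < s_k = n`, the probability that
the d-descent set of the `(b,n,p)`-shuffle equals `{s_1,…,s_{k-1},n}` is
`b⁻ⁿ · det(f(i,j))_{i,j=0,…,k-1}` with `f(i,j) = binom(s_{j+1} - s_i + b - 1, b-1)` for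
`j ≤ k-2` and `f(i,k-1) = binom(n - s_i + b - 1, b-1) - binom(n - s_i + c, c)`. -/
theorem statement1 (p c n k : ℕ) (hp : 1 ≤ p) (hc : 1 ≤ c) (hn : 1 ≤ n) (hk : 1 ≤ k)
    (b : ℕ) (hb : b = p * c + 1)
    (s : ℕ → ℕ) (hs0 : s 0 = 0) (hmono : ∀ i, i < k → s i < s (i + 1))
    (hlast : s k = n) :
    ((Finset.univ.filter fun A : Fin n → Fin b =>
        shuffleDDescentSet p A = (Finset.Icc 1 k).image s).card : ℝ) / (b : ℝ) ^ n
      = ((b : ℝ) ^ n)⁻¹ *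
        (Matrix.of fun i j : Fin k =>
          if (j : ℕ) = k - 1 then
            (zchoose ((n : ℤ) - s (i : ℕ) + b - 1) (b - 1) : ℝ)
              - (zchoose ((n : ℤ) - s (i : ℕ) + c) c : ℝ)
          else (zchoose ((s ((j : ℕ) + 1) : ℤ) - s (i : ℕ) + b - 1) (b - 1) : ℝ)).det := by
  have hcb : c < b := by rw [hb]; nlinarith
  rw [det_eq p c n k hc hn hk b hcb s hs0 hmono hlast, ← count_total b c hcb _ n hn, div_eq_inv_mul]
  congr 1
  subst hb
  rw [Finset.card_filter]
  push_cast
  refine Eq.trans ?_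
    ((Equiv.piCongrRight (fun _ : Fin n => Equiv.ofBijective _ (phiF_bij p c hp))).sum_comp _)
  refine Finset.sum_congr rfl fun A _ => ?_
  simp only [set_iff p c n k hp A s hs0 hmono hlast]
  rfl
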